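/- arXiv:1802.09351 — 2 statements merged into one kernel-verified Lean document; each statement's English description precedes it below -/
import Mathlib

section
/- In the embedded-hyperbolic-plane setting, the set {x_+(t/2) ∘ x_+(t)⁻¹ : t > 0} ∪ {x_−(t) ∘ x_−(t/2)⁻¹ : t > 0} generates the restricted transvection group Trans(X)|_ℍ, i.e., the subgroup of the group of bijections of X generated by {s_{f(g)} ∘ s_o : g ∈ SL(2,ℝ)}. -/
open Matrix

/-- `SL(2,ℝ)`. -/
abbrev SL2 := Matrix.SpecialLinearGroup (Fin 2) ℝ

/-- The transpose, as a map `SL(2,ℝ) → SL(2,ℝ)`. -/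
def transpSL (g : SL2) : SL2 :=
  ⟨(g : Matrix (Fin 2) (Fin 2) ℝ)ᵀ, by rw [Matrix.det_transpose]; exact g.2⟩

/-- The Cartan--Chevalley involution `θ(g) = (gᵀ)⁻¹` of `SL(2,ℝ)`. -/
def thetaSL (g : SL2) : SL2 := (transpSL g)⁻¹

/-- The twist map `τ(g) = g gᵀ` of `SL(2,ℝ)`. -/
def tauSL (g : SL2) : SL2 := g * transpSL g

noncomputable def Amat (t : ℝ) : Matrix (Fin 2) (Fin 2) ℝ :=
  (Real.sqrt 2)⁻¹ • !![3 * t, -1; -1, 1 / t]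

noncomputable def Bmat (t : ℝ) : Matrix (Fin 2) (Fin 2) ℝ :=
  !![1 / t, 1; 1, 2 * t]

noncomputable def Cmat : Matrix (Fin 2) (Fin 2) ℝ :=
  !![(Real.sqrt 2)⁻¹, 0; 0, Real.sqrt 2]

/-- The upper shear matrix `[[1,t],[0,1]]` as an element of `SL(2,ℝ)`. -/
def shearU (t : ℝ) : SL2 := ⟨!![1, t; 0, 1], by simp [Matrix.det_fin_two_of]⟩

/-- The lower shear matrix `[[1,0],[t,1]]` as an element of `SL(2,ℝ)`. -/
def shearL (t : ℝ) : SL2 := ⟨!![1, 0; t, 1], by simp [Matrix.det_fin_two_of]⟩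

/-- The elementary reflection `s_x : y ↦ x.y` of a reflection space, as a permutation;
it is an involutive bijection by (RS2). -/
def elemRefl {X : Type*} (μ : X → X → X) (rs2 : ∀ x y, μ x (μ x y) = y) (x : X) :
    Equiv.Perm X :=
  ⟨μ x, μ x, rs2 x, rs2 x⟩

/-- The elementary transvection `tr_{f(g)} = s_{f(g)} ∘ s_o`. -/
def trv {X : Type*} (μ : X → X → X) (rs2 : ∀ x y, μ x (μ x y) = y) (o : X)
    (f : SL2 → X) (g : SL2) : Equiv.Perm X :=
  elemRefl μ rs2 (f g) * elemRefl μ rs2 o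

/-- `x_+(t) = tr_{f(a(t))} ∘ tr_{f(b(t))} ∘ tr_{f(c)}`. -/
def xplus {X : Type*} (μ : X → X → X) (rs2 : ∀ x y, μ x (μ x y) = y) (o : X)
    (f : SL2 → X) (a b : ℝ → SL2) (c : SL2) (t : ℝ) : Equiv.Perm X :=
  trv μ rs2 o f (a t) * trv μ rs2 o f (b t) * trv μ rs2 o f c

/-- `x_−(t) = tr_{f(c)} ∘ tr_{f(b(t))} ∘ tr_{f(a(t))}`. -/
def xminus {X : Type*} (μ : X → X → X) (rs2 : ∀ x y, μ x (μ x y) = y) (o : X)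
    (f : SL2 → X) (a b : ℝ → SL2) (c : SL2) (t : ℝ) : Equiv.Perm X :=
  trv μ rs2 o f c * trv μ rs2 o f (b t) * trv μ rs2 o f (a t)


/-- `φ` is an automorphism of `μ` which acts on the image of `f` as left multiplication by `g`. -/
structure ActsAs {X : Type*} (μ : X → X → X) (f : SL2 → X) (φ : Equiv.Perm X) (g : SL2) :
    Prop where
  map_mul : ∀ x y, φ (μ x y) = μ (φ x) (φ y)
  apply_eq : ∀ h, φ (f h) = f (g * h)

namespace ActsAs

variable {X : Type*} {μ : X → X → X} {f : SL2 → X} {φ ψ : Equiv.Perm X} {g h : SL2}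

lemma one : ActsAs μ f 1 1 := ⟨fun _ _ => rfl, fun h => by simp⟩

lemma mul (hφ : ActsAs μ f φ g) (hψ : ActsAs μ f ψ h) : ActsAs μ f (φ * ψ) (g * h) where
  map_mul x y := by simp [hψ.map_mul, hφ.map_mul]
  apply_eq k := by simp [hψ.apply_eq, hφ.apply_eq, mul_assoc]

lemma inv (hφ : ActsAs μ f φ g) : ActsAs μ f φ⁻¹ g⁻¹ where
  map_mul x y := by
    rw [Equiv.Perm.inv_eq_iff_eq, hφ.map_mul]
    simp
  apply_eq k := by
    rw [Equiv.Perm.inv_eq_iff_eq, hφ.apply_eq, mul_inv_cancel_left]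

lemma conj_elemRefl (hφ : ActsAs μ f φ g) (rs2 : ∀ x y, μ x (μ x y) = y) (x : X) :
    φ * elemRefl μ rs2 x * φ⁻¹ = elemRefl μ rs2 (φ x) := by
  ext y
  simp [elemRefl, hφ.map_mul]

/-- Two permutations acting by the same `g` differ by a factor commuting with the
transvections. -/
lemma commute_of_mem_closure (hφ : ActsAs μ f φ g) (hψ : ActsAs μ f ψ g)
    (rs2 : ∀ x y, μ x (μ x y) = y) {o : X} (hf1 : f 1 = o) {χ : Equiv.Perm X}
    (hχ : χ ∈ Subgroup.closure {p : Equiv.Perm X | ∃ g : SL2,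
      p = elemRefl μ rs2 (f g) * elemRefl μ rs2 o}) :
    Commute (ψ⁻¹ * φ) χ := by
  have hz := hψ.inv.mul hφ
  rw [inv_mul_cancel] at hz
  have hrefl (k : SL2) : Commute (ψ⁻¹ * φ) (elemRefl μ rs2 (f k)) := by
    have hk := hz.conj_elemRefl rs2 (f k)
    rw [hz.apply_eq, one_mul] at hk
    exact mul_inv_eq_iff_eq_mul.mp hk
  induction hχ using Subgroup.closure_induction with
  | mem p hp =>
    obtain ⟨k, rfl⟩ := hp
    rw [← hf1]
    exact (hrefl k).mul_right (hrefl 1)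
  | one => exact Commute.one_right _
  | mul p q _ _ hp hq => exact hp.mul_right hq
  | inv p _ hp => exact hp.inv_right

end ActsAs

lemma coe_transpSL (g : SL2) :
    (transpSL g : Matrix (Fin 2) (Fin 2) ℝ) = (g : Matrix (Fin 2) (Fin 2) ℝ)ᵀ := rfl

lemma coe_shearU (t : ℝ) : (shearU t : Matrix (Fin 2) (Fin 2) ℝ) = !![1, t; 0, 1] := rfl

lemma coe_shearL (t : ℝ) : (shearL t : Matrix (Fin 2) (Fin 2) ℝ) = !![1, 0; t, 1] := rfl

lemma transpSL_one : transpSL 1 = 1 := by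
  ext i j
  simp [transpSL]

lemma transpSL_mul (g h : SL2) : transpSL (g * h) = transpSL h * transpSL g :=
  Subtype.ext (Matrix.transpose_mul _ _)

lemma transpSL_transpSL (g : SL2) : transpSL (transpSL g) = g := by
  ext i j
  simp [transpSL]

lemma transpSL_inv (g : SL2) : transpSL g⁻¹ = (transpSL g)⁻¹ := by
  rw [eq_inv_iff_mul_eq_one, ← transpSL_mul, mul_inv_cancel, transpSL_one]

lemma thetaSL_one : thetaSL 1 = 1 := by
  simp [thetaSL, transpSL_one]

lemma thetaSL_thetaSL (g : SL2) : thetaSL (thetaSL g) = g := by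
  simp [thetaSL, transpSL_inv, transpSL_transpSL]

lemma tauSL_one : tauSL 1 = 1 := by
  simp [tauSL, transpSL_one]

lemma tauSL_of_transpSL_eq {g : SL2} (hg : transpSL g = g) : tauSL g = g * g := by
  rw [tauSL, hg]

lemma transpSL_eq_self_of_posDef {g : SL2}
    (hg : ((g : Matrix (Fin 2) (Fin 2) ℝ)).PosDef) : transpSL g = g := by
  apply Subtype.ext
  have h := hg.isHermitian.eq
  rwa [Matrix.conjTranspose_eq_transpose_of_trivial] at h

lemma actsAs_trv {X : Type*} {μ : X → X → X} (rs2 : ∀ x y, μ x (μ x y) = y)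
    (rs3 : ∀ x y z, μ x (μ y z) = μ (μ x y) (μ x z))
    {o : X} {f : SL2 → X} (hf1 : f 1 = o)
    (hfμ : ∀ g h : SL2, f (tauSL g * thetaSL h) = μ (f g) (f h)) (g : SL2) :
    ActsAs μ f (trv μ rs2 o f g) (tauSL g) where
  map_mul x y := by
    change μ (f g) (μ o (μ x y)) = μ (μ (f g) (μ o x)) (μ (f g) (μ o y))
    rw [rs3 o, rs3 (f g)]
  apply_eq h := by
    change μ (f g) (μ o (f h)) = _
    rw [← hf1, ← hfμ, tauSL_one, one_mul, ← hfμ, thetaSL_thetaSL]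

lemma shearU_add (s t : ℝ) : shearU (s + t) = shearU s * shearU t := by
  ext i j
  fin_cases i <;> fin_cases j <;> simp [coe_shearU, Matrix.mul_apply, add_comm]

lemma shearL_add (s t : ℝ) : shearL (s + t) = shearL s * shearL t := by
  ext i j
  fin_cases i <;> fin_cases j <;> simp [coe_shearL, Matrix.mul_apply]

lemma shearU_zero : shearU 0 = 1 := by
  ext i j
  fin_cases i <;> fin_cases j <;> simp [shearU]

lemma shearL_zero : shearL 0 = 1 := by
  ext i j
  fin_cases i <;> fin_cases j <;> simp [shearL]

lemma shearU_neg (t : ℝ) : shearU (-t) = (shearU t)⁻¹ := by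
  rw [eq_inv_iff_mul_eq_one, ← shearU_add, neg_add_cancel, shearU_zero]

lemma shearL_neg (t : ℝ) : shearL (-t) = (shearL t)⁻¹ := by
  rw [eq_inv_iff_mul_eq_one, ← shearL_add, neg_add_cancel, shearL_zero]

/-- `SL(2,ℝ)` is generated by the upper and lower shear matrices with positive parameter. -/
lemma eq_top_of_shears_mem (H : Subgroup SL2) (hU : ∀ t : ℝ, 0 < t → shearU t ∈ H)
    (hL : ∀ t : ℝ, 0 < t → shearL t ∈ H) : H = ⊤ := by
  have hU' (t : ℝ) : shearU t ∈ H := by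
    rcases lt_trichotomy t 0 with ht | rfl | ht
    · rw [← neg_neg t, shearU_neg]
      exact H.inv_mem (hU _ (neg_pos.mpr ht))
    · rw [shearU_zero]
      exact H.one_mem
    · exact hU t ht
  have hL' (t : ℝ) : shearL t ∈ H := by
    rcases lt_trichotomy t 0 with ht | rfl | ht
    · rw [← neg_neg t, shearL_neg]
      exact H.inv_mem (hL _ (neg_pos.mpr ht))
    · rw [shearL_zero]
      exact H.one_mem
    · exact hL t ht
  have hmem (g : SL2) (hg : g 1 0 ≠ 0) : g ∈ H := by
    have hdet : g 0 0 * g 1 1 - g 0 1 * g 1 0 = 1 := by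
      rw [← Matrix.det_fin_two]
      exact g.2
    have : g = shearU ((g 0 0 - 1) / g 1 0) * shearL (g 1 0) *
        shearU ((g 1 1 - 1) / g 1 0) := by
      ext i j
      fin_cases i <;> fin_cases j <;>
        simp [coe_shearU, coe_shearL, Matrix.mul_apply] <;> field_simp <;> linarith
    rw [this]
    exact H.mul_mem (H.mul_mem (hU' _) (hL' _)) (hU' _)
  refine (Subgroup.eq_top_iff' H).mpr fun g => ?_
  by_cases hg : g 1 0 = 0
  · rw [← H.mul_mem_cancel_left (hL' 1)]
    refine hmem _ fun h => ?_
    have hdet : g 0 0 * g 1 1 - g 0 1 * g 1 0 = 1 := by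
      rw [← Matrix.det_fin_two]
      exact g.2
    simp [coe_shearL, Matrix.mul_apply, hg] at h
    simp [h, hg] at hdet
  · exact hmem g hg

/-- A symmetric matrix in `SL(2,ℝ)` of positive trace has a square root of the same kind, namely
`(g + 1) / √(tr g + 2)`. -/
lemma exists_symm_sqrt (g : SL2) (hg : transpSL g = g) (htr : 0 < g 0 0 + g 1 1) :
    ∃ h : SL2, transpSL h = h ∧ 0 < h 0 0 + h 1 1 ∧ h * h = g := by
  have hsymm : g 1 0 = g 0 1 := by
    conv_lhs => rw [← hg]
    rfl
  have hdet : g 0 0 * g 1 1 - g 0 1 * g 0 1 = 1 := by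
    nth_rw 2 [← hsymm]
    rw [← Matrix.det_fin_two]
    exact g.2
  have hpos : 0 < g 0 0 + g 1 1 + 2 := by linarith
  obtain ⟨r, hr, hr2⟩ : ∃ r : ℝ, 0 < r ∧ r * r = g 0 0 + g 1 1 + 2 :=
    ⟨_, Real.sqrt_pos.mpr hpos, Real.mul_self_sqrt hpos.le⟩
  have hr0 := hr.ne'
  obtain ⟨h, hcoe⟩ : ∃ h : SL2, (h : Matrix (Fin 2) (Fin 2) ℝ) =
      !![(g 0 0 + 1) / r, g 0 1 / r; g 0 1 / r, (g 1 1 + 1) / r] := by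
    refine ⟨⟨_, ?_⟩, rfl⟩
    rw [Matrix.det_fin_two_of]
    field_simp
    linarith
  refine ⟨h, ?_, ?_, ?_⟩
  · ext i j
    fin_cases i <;> fin_cases j <;> simp [coe_transpSL, hcoe]
  · have htrace : h 0 0 + h 1 1 = (g 0 0 + g 1 1 + 2) / r := by
      simp [hcoe]
      ring
    rw [htrace]
    exact div_pos hpos hr
  · ext i j
    fin_cases i <;> fin_cases j <;>
      simp [Matrix.mul_apply, hsymm, hcoe] <;> field_simp <;> rw [pow_two r, hr2] <;> linarith

/-- Every `τ(g)` is the fourth power of a symmetric matrix. -/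
lemma exists_symm_fourth_root (g : SL2) :
    ∃ h : SL2, transpSL h = h ∧ h * h * (h * h) = tauSL g := by
  have hdet : g 0 0 * g 1 1 - g 0 1 * g 1 0 = 1 := by
    rw [← Matrix.det_fin_two]
    exact g.2
  obtain ⟨k, hk, hktr, hkg⟩ := exists_symm_sqrt (tauSL g)
    (by rw [tauSL, transpSL_mul, transpSL_transpSL])
    (by
      simp [tauSL, coe_transpSL, Matrix.mul_apply]
      nlinarith [sq_nonneg (g 0 0 - g 1 1), sq_nonneg (g 0 1 + g 1 0)])
  obtain ⟨h, hh, -, hhk⟩ := exists_symm_sqrt k hk hktr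
  exact ⟨h, hh, by rw [hhk, hkg]⟩

/-- The rotation by `π / 2`. -/
def quarterTurn : SL2 := ⟨!![0, -1; 1, 0], by simp [Matrix.det_fin_two_of]⟩

lemma coe_quarterTurn :
    (quarterTurn : Matrix (Fin 2) (Fin 2) ℝ) = !![0, -1; 1, 0] := rfl

lemma quarterTurn_mul_transpSL : quarterTurn * transpSL quarterTurn = 1 := by
  ext i j
  fin_cases i <;> fin_cases j <;> simp [coe_quarterTurn, coe_transpSL, Matrix.mul_apply]

lemma symm_mul_quarterTurn_mul {h : SL2} (hh : transpSL h = h) :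
    h * quarterTurn * h = quarterTurn := by
  have hsymm : h 1 0 = h 0 1 := by
    conv_lhs => rw [← hh]
    rfl
  have hdet : h 0 0 * h 1 1 - h 0 1 * h 0 1 = 1 := by
    nth_rw 2 [← hsymm]
    rw [← Matrix.det_fin_two]
    exact h.2
  ext i j
  fin_cases i <;> fin_cases j <;>
    simp [coe_quarterTurn, Matrix.mul_apply, hsymm] <;> linarith

lemma Amat_mul_Bmat_mul_Cmat {t : ℝ} (ht : 0 < t) :
    Amat t * Bmat t * Cmat = !![1, t; 0, 1] := by
  have h2 : Real.sqrt 2 ≠ 0 := by positivity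
  have hs : Real.sqrt 2 ^ 2 = 2 := Real.sq_sqrt (by norm_num)
  ext i j
  fin_cases i <;> fin_cases j <;>
    simp [Amat, Bmat, Cmat, Matrix.mul_apply] <;> field_simp <;> (try rw [hs]) <;> ring

lemma Cmat_mul_Bmat_mul_Amat {t : ℝ} (ht : 0 < t) :
    Cmat * Bmat t * Amat t = !![1, 0; t, 1] := by
  have hA : (Amat t)ᵀ = Amat t := by
    ext i j
    fin_cases i <;> fin_cases j <;> simp [Amat]
  have hB : (Bmat t)ᵀ = Bmat t := by
    ext i j
    fin_cases i <;> fin_cases j <;> simp [Bmat]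
  have hC : Cmatᵀ = Cmat := by
    ext i j
    fin_cases i <;> fin_cases j <;> simp [Cmat]
  have h := congrArg Matrix.transpose (Amat_mul_Bmat_mul_Cmat ht)
  rw [Matrix.transpose_mul, Matrix.transpose_mul, hA, hB, hC, ← Matrix.mul_assoc] at h
  rw [h]
  ext i j
  fin_cases i <;> fin_cases j <;> simp

/-- In the embedded-hyperbolic-plane setting, the set
`{x_+(t/2) ∘ x_+(t)⁻¹ : t > 0} ∪ {x_−(t) ∘ x_−(t/2)⁻¹ : t > 0}` generates the restricted
transvection group `Trans(X)|_ℍ`, i.e. the subgroup of the permutation group of `X`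
generated by `{s_{f(g)} ∘ s_o : g ∈ SL(2,ℝ)}`. -/
theorem halved_products_generate {X : Type*} (μ : X → X → X)
    (rs1 : ∀ x, μ x x = x)
    (rs2 : ∀ x y, μ x (μ x y) = y)
    (rs3 : ∀ x y z, μ x (μ y z) = μ (μ x y) (μ x z))
    (o : X) (f : SL2 → X)
    (hf1 : f 1 = o)
    (hfK : ∀ g h : SL2, f g = f h ↔ (g⁻¹ * h) * transpSL (g⁻¹ * h) = 1)
    (hfμ : ∀ g h : SL2, f (tauSL g * thetaSL h) = μ (f g) (f h))
    (a b : ℝ → SL2) (c : SL2)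
    (ha : ∀ t : ℝ, 0 < t → ((a t : Matrix (Fin 2) (Fin 2) ℝ)).PosDef ∧
      (a t : Matrix (Fin 2) (Fin 2) ℝ) * (a t : Matrix (Fin 2) (Fin 2) ℝ) = Amat t)
    (hb : ∀ t : ℝ, 0 < t → ((b t : Matrix (Fin 2) (Fin 2) ℝ)).PosDef ∧
      (b t : Matrix (Fin 2) (Fin 2) ℝ) * (b t : Matrix (Fin 2) (Fin 2) ℝ) = Bmat t)
    (hc : ((c : Matrix (Fin 2) (Fin 2) ℝ)).PosDef ∧
      (c : Matrix (Fin 2) (Fin 2) ℝ) * (c : Matrix (Fin 2) (Fin 2) ℝ) = Cmat) :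
    Subgroup.closure
      {p : Equiv.Perm X | ∃ t : ℝ, 0 < t ∧
        (p = xplus μ rs2 o f a b c (t / 2) * (xplus μ rs2 o f a b c t)⁻¹ ∨
         p = xminus μ rs2 o f a b c t * (xminus μ rs2 o f a b c (t / 2))⁻¹)}
      = Subgroup.closure
        {p : Equiv.Perm X | ∃ g : SL2, p = elemRefl μ rs2 (f g) * elemRefl μ rs2 o} := by
  set T := Subgroup.closure
    {p : Equiv.Perm X | ∃ g : SL2, p = elemRefl μ rs2 (f g) * elemRefl μ rs2 o} with hT
  set H := Subgroup.closure
    {p : Equiv.Perm X | ∃ t : ℝ, 0 < t ∧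
      (p = xplus μ rs2 o f a b c (t / 2) * (xplus μ rs2 o f a b c t)⁻¹ ∨
       p = xminus μ rs2 o f a b c t * (xminus μ rs2 o f a b c (t / 2))⁻¹)} with hH
  have htrv (g : SL2) : trv μ rs2 o f g ∈ T := Subgroup.subset_closure ⟨g, rfl⟩
  have hplusT (t : ℝ) : xplus μ rs2 o f a b c t ∈ T :=
    T.mul_mem (T.mul_mem (htrv _) (htrv _)) (htrv _)
  have hminusT (t : ℝ) : xminus μ rs2 o f a b c t ∈ T :=
    T.mul_mem (T.mul_mem (htrv _) (htrv _)) (htrv _)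
  have hHT : H ≤ T := by
    rw [hH, Subgroup.closure_le]
    rintro p ⟨t, -, rfl | rfl⟩
    · exact T.mul_mem (hplusT _) (T.inv_mem (hplusT _))
    · exact T.mul_mem (hminusT _) (T.inv_mem (hminusT _))
  have hact := actsAs_trv rs2 rs3 hf1 hfμ
  have hplus (t : ℝ) (ht : 0 < t) : ActsAs μ f (xplus μ rs2 o f a b c t) (shearU t) := by
    have h : tauSL (a t) * tauSL (b t) * tauSL c = shearU t := by
      rw [tauSL_of_transpSL_eq (transpSL_eq_self_of_posDef (ha t ht).1),
        tauSL_of_transpSL_eq (transpSL_eq_self_of_posDef (hb t ht).1),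
        tauSL_of_transpSL_eq (transpSL_eq_self_of_posDef hc.1)]
      apply Subtype.ext
      simp only [Matrix.SpecialLinearGroup.coe_mul]
      rw [(ha t ht).2, (hb t ht).2, hc.2, Amat_mul_Bmat_mul_Cmat ht]
      rfl
    rw [← h]
    exact ((hact _).mul (hact _)).mul (hact _)
  have hminus (t : ℝ) (ht : 0 < t) : ActsAs μ f (xminus μ rs2 o f a b c t) (shearL t) := by
    have h : tauSL c * tauSL (b t) * tauSL (a t) = shearL t := by
      rw [tauSL_of_transpSL_eq (transpSL_eq_self_of_posDef (ha t ht).1),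
        tauSL_of_transpSL_eq (transpSL_eq_self_of_posDef (hb t ht).1),
        tauSL_of_transpSL_eq (transpSL_eq_self_of_posDef hc.1)]
      apply Subtype.ext
      simp only [Matrix.SpecialLinearGroup.coe_mul]
      rw [(ha t ht).2, (hb t ht).2, hc.2, Cmat_mul_Bmat_mul_Amat ht]
      rfl
    rw [← h]
    exact ((hact _).mul (hact _)).mul (hact _)
  have hlift (g : SL2) : ∃ φ ∈ H, ActsAs μ f φ g := by
    let L : Subgroup SL2 :=
      { carrier := {g | ∃ φ ∈ H, ActsAs μ f φ g}
        mul_mem' := by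
          rintro g h ⟨φ, hφ, hφg⟩ ⟨ψ, hψ, hψh⟩
          exact ⟨_, H.mul_mem hφ hψ, hφg.mul hψh⟩
        one_mem' := ⟨1, H.one_mem, ActsAs.one⟩
        inv_mem' := by
          rintro g ⟨φ, hφ, hφg⟩
          exact ⟨_, H.inv_mem hφ, hφg.inv⟩ }
    have hL : L = ⊤ := by
      refine eq_top_of_shears_mem L (fun t ht => ?_) (fun t ht => ?_)
      · rw [← L.inv_mem_iff]
        refine ⟨_, Subgroup.subset_closure ⟨2 * t, by positivity, Or.inl rfl⟩, ?_⟩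
        have h := (hplus (2 * t / 2) (by positivity)).mul (hplus (2 * t) (by positivity)).inv
        rwa [← shearU_neg, ← shearU_add, show 2 * t / 2 + -(2 * t) = -t by ring,
          shearU_neg] at h
      · refine ⟨_, Subgroup.subset_closure ⟨2 * t, by positivity, Or.inr rfl⟩, ?_⟩
        have h := (hminus (2 * t) (by positivity)).mul (hminus (2 * t / 2) (by positivity)).inv
        rwa [← shearL_neg, ← shearL_add, show 2 * t + -(2 * t / 2) = t by ring] at h
    exact (Subgroup.eq_top_iff' L).mp hL g
  refine le_antisymm hHT ?_
  rw [hT, Subgroup.closure_le]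
  rintro p ⟨g, rfl⟩
  obtain ⟨h, hh, hhg⟩ := exists_symm_fourth_root g
  have hfg : μ (f h) o = f g := by
    rw [← hf1, ← hfμ, thetaSL_one, mul_one, tauSL_of_transpSL_eq hh, hfK, transpSL_mul,
      transpSL_inv, transpSL_mul, hh, mul_assoc, ← mul_assoc g, ← tauSL, ← hhg]
    group
  obtain ⟨φ, hφH, hφ⟩ := hlift (h * quarterTurn)
  obtain ⟨ψ, hψH, hψ⟩ := hlift (tauSL h)
  have hφo : φ o = f h := by
    rw [← hf1, hφ.apply_eq, mul_one, eq_comm, hfK, inv_mul_cancel_left,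
      quarterTurn_mul_transpSL]
  have hφh : φ (f h) = o := by
    rw [hφ.apply_eq, symm_mul_quarterTurn_mul hh, ← hf1, eq_comm, hfK, inv_one, one_mul,
      quarterTurn_mul_transpSL]
  have hcomm : Commute (ψ⁻¹ * trv μ rs2 o f h) φ :=
    (hact h).commute_of_mem_closure hψ rs2 hf1 (hHT hφH)
  have hsq (x : X) : elemRefl μ rs2 x * elemRefl μ rs2 x = 1 := Equiv.ext (rs2 x)
  have hinv (x : X) : (elemRefl μ rs2 x)⁻¹ = elemRefl μ rs2 x :=
    inv_eq_of_mul_eq_one_right (hsq x)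
  have hconj : φ * trv μ rs2 o f h * φ⁻¹ = (trv μ rs2 o f h)⁻¹ := by
    rw [trv, _root_.mul_inv_rev, hinv, hinv]
    calc _ = (φ * elemRefl μ rs2 (f h) * φ⁻¹) * (φ * elemRefl μ rs2 o * φ⁻¹) := by group
      _ = _ := by rw [hφ.conj_elemRefl, hφ.conj_elemRefl, hφo, hφh]
  have hsquare : elemRefl μ rs2 (f g) * elemRefl μ rs2 o =
      trv μ rs2 o f h * trv μ rs2 o f h := by
    ext y
    change μ (f g) (μ o y) = μ (f h) (μ o (μ (f h) (μ o y)))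
    rw [rs3 (f h) o, hfg, rs2 (f h)]
  have hcommutator : trv μ rs2 o f h * trv μ rs2 o f h = ψ * φ * ψ⁻¹ * φ⁻¹ := by
    calc _ = trv μ rs2 o f h * (φ * trv μ rs2 o f h * φ⁻¹)⁻¹ := by rw [hconj, inv_inv]
      _ = ψ * ((ψ⁻¹ * trv μ rs2 o f h) * φ) * (trv μ rs2 o f h)⁻¹ * φ⁻¹ := by group
      _ = ψ * (φ * (ψ⁻¹ * trv μ rs2 o f h)) * (trv μ rs2 o f h)⁻¹ * φ⁻¹ := by rw [hcomm.eq]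
      _ = _ := by group
  rw [SetLike.mem_coe, hsquare, hcommutator]
  exact H.mul_mem (H.mul_mem (H.mul_mem hψH hφH) (H.inv_mem hψH)) (H.inv_mem hφH)
end

section
/- In the embedded-hyperbolic-plane setting, the restricted transvection group Trans(X)|_ℍ (the subgroup of the group of bijections of X generated by {s_{f(g)} ∘ s_o : g ∈ SL(2,ℝ)}) is perfect, i.e., it equals its own commutator subgroup; moreover, every element of Trans(X)|_ℍ that fixes f(g) for all g ∈ SL(2,ℝ) is central in Trans(X)|_ℍ. Consequently Trans(X)|_ℍ is a perfect central extension of its image in the group of bijections of the embedded hyperbolic plane. -/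
open Matrix

open scoped commutatorElement

namespace SL2

/-- The upper triangular unipotent matrix with off-diagonal entry `x`. -/
def upper (x : ℝ) : SL2 := ⟨!![1, x; 0, 1], by simp⟩

/-- The lower triangular unipotent matrix with off-diagonal entry `x`. -/
def lower (x : ℝ) : SL2 := ⟨!![1, 0; x, 1], by simp⟩

/-- The rotation by a quarter turn. -/
def weyl : SL2 := ⟨!![0, 1; -1, 0], by simp⟩

/-- The diagonal matrix with entries `2` and `2⁻¹`. -/
noncomputable def dilation : SL2 := ⟨!![2, 0; 0, 2⁻¹], by simp⟩

theorem coe_upper (x : ℝ) : (upper x : Matrix (Fin 2) (Fin 2) ℝ) = !![1, x; 0, 1] := rfl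

theorem coe_lower (x : ℝ) : (lower x : Matrix (Fin 2) (Fin 2) ℝ) = !![1, 0; x, 1] := rfl

theorem coe_weyl : (weyl : Matrix (Fin 2) (Fin 2) ℝ) = !![0, 1; -1, 0] := rfl

theorem coe_dilation : (dilation : Matrix (Fin 2) (Fin 2) ℝ) = !![2, 0; 0, 2⁻¹] := rfl

theorem upper_mem_of_normal {N : Subgroup SL2} (hN : N.Normal)
    (hd : dilation * dilation ∈ N) (x : ℝ) : upper x ∈ N := by
  have h : upper x =
      dilation * dilation * (upper (x / 15) * (dilation * dilation)⁻¹ * (upper (x / 15))⁻¹) := by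
    ext i j
    fin_cases i <;> fin_cases j <;>
      simp [coe_upper, coe_dilation, Matrix.mul_apply, Fin.sum_univ_two,
        Matrix.adjugate_fin_two] <;> ring
  rw [h]
  exact N.mul_mem hd (hN.conj_mem _ (N.inv_mem hd) _)

theorem lower_mem_of_normal {N : Subgroup SL2} (hN : N.Normal)
    (hd : dilation * dilation ∈ N) (x : ℝ) : lower x ∈ N := by
  have h : lower x = weyl * upper (-x) * weyl⁻¹ := by
    ext i j
    fin_cases i <;> fin_cases j <;>
      simp [coe_upper, coe_lower, coe_weyl, Matrix.mul_apply, Fin.sum_univ_two,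
        Matrix.adjugate_fin_two]
  rw [h]
  exact hN.conj_mem _ (upper_mem_of_normal hN hd _) _

theorem eq_upper_mul_lower_mul_upper (g : SL2) (hg : g 1 0 ≠ 0) :
    g = upper ((g 0 0 - 1) / g 1 0) * lower (g 1 0) * upper ((g 1 1 - 1) / g 1 0) := by
  have hdet := g.2
  rw [Matrix.det_fin_two] at hdet
  ext i j
  fin_cases i <;> fin_cases j <;>
    simp [coe_upper, coe_lower, Matrix.mul_apply, Fin.sum_univ_two] <;> field_simp
  · ring
  · linear_combination -hdet
  · ring

/-- A normal subgroup of `SL(2,ℝ)` containing `diag(4, 1/4)` is everything. -/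
theorem eq_top_of_normal {N : Subgroup SL2} (hN : N.Normal)
    (hd : dilation * dilation ∈ N) : N = ⊤ := by
  have key : ∀ g : SL2, g 1 0 ≠ 0 → g ∈ N := fun g hg => by
    rw [eq_upper_mul_lower_mul_upper g hg]
    exact N.mul_mem (N.mul_mem (upper_mem_of_normal hN hd _) (lower_mem_of_normal hN hd _))
      (upper_mem_of_normal hN hd _)
  refine (Subgroup.eq_top_iff' N).2 fun g => ?_
  by_cases hg : g 1 0 = 0
  · rw [← N.mul_mem_cancel_left (lower_mem_of_normal hN hd 1)]
    refine key _ fun h => ?_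
    have hdet := g.2
    rw [Matrix.det_fin_two] at hdet
    simp [coe_lower, Matrix.mul_apply, Fin.sum_univ_two, hg] at h
    simp [h, hg] at hdet
  · exact key g hg

theorem commutator_eq_top : commutator SL2 = ⊤ := by
  refine eq_top_of_normal inferInstance ?_
  have h : dilation * dilation = ⁅dilation, weyl⁆ := by
    ext i j
    fin_cases i <;> fin_cases j <;>
      simp [coe_dilation, coe_weyl, commutatorElement_def, Matrix.mul_apply, Fin.sum_univ_two,
        Matrix.adjugate_fin_two]
  rw [h]
  exact Subgroup.commutator_mem_commutator (Subgroup.mem_top _) (Subgroup.mem_top _)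

theorem coe_transpSL (g : SL2) :
    (transpSL g : Matrix (Fin 2) (Fin 2) ℝ) = (g : Matrix (Fin 2) (Fin 2) ℝ)ᵀ := rfl

theorem transpSL_mul (g h : SL2) : transpSL (g * h) = transpSL h * transpSL g :=
  Subtype.ext (Matrix.transpose_mul _ _)

theorem thetaSL_thetaSL (g : SL2) : thetaSL (thetaSL g) = g := by
  have h : transpSL (transpSL g)⁻¹ * transpSL (transpSL g) = 1 := by
    rw [← transpSL_mul, mul_inv_cancel]
    exact Subtype.ext Matrix.transpose_one
  exact inv_eq_of_mul_eq_one_right h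

theorem tauSL_one : tauSL 1 = 1 := by
  rw [tauSL, one_mul]
  exact Subtype.ext Matrix.transpose_one

/-- `SL(2,ℝ)` is generated by the symmetric matrices `g gᵀ`. -/
theorem closure_range_tauSL : Subgroup.closure (Set.range tauSL) = ⊤ := by
  refine eq_top_of_normal ⟨fun a ha s => ?_⟩ (Subgroup.subset_closure ⟨dilation, ?_⟩)
  · induction ha using Subgroup.closure_induction with
    | mem x hx =>
      obtain ⟨g, rfl⟩ := hx
      have h : s * tauSL g * s⁻¹ = tauSL (s * g) * (tauSL s)⁻¹ := by
        simp only [tauSL, transpSL_mul]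
        group
      rw [h]
      exact mul_mem (Subgroup.subset_closure ⟨_, rfl⟩)
        (inv_mem (Subgroup.subset_closure ⟨_, rfl⟩))
    | one => simp
    | mul x y _ _ hx hy => simpa [mul_assoc] using mul_mem hx hy
    | inv x _ hx => simpa [mul_assoc] using inv_mem hx
  · ext i j
    fin_cases i <;> fin_cases j <;>
      simp [tauSL, coe_transpSL, coe_dilation, Matrix.mul_apply, Fin.sum_univ_two]

end SL2

section Reflections

variable {X : Type*} {μ : X → X → X} {rs2 : ∀ x y, μ x (μ x y) = y}

theorem conj_elemRefl {p : Equiv.Perm X} (hp : ∀ x y, p (μ x y) = μ (p x) (p y)) (x : X) :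
    p * elemRefl μ rs2 x * p⁻¹ = elemRefl μ rs2 (p x) := by
  rw [mul_inv_eq_iff_eq_mul]
  exact Equiv.ext (hp x)

theorem elemRefl_mul_self (x : X) : elemRefl μ rs2 x * elemRefl μ rs2 x = 1 :=
  Equiv.ext (rs2 x)

/-- Automorphisms of the operation `μ`. -/
def reflAut (μ : X → X → X) : Subgroup (Equiv.Perm X) where
  carrier := {p | ∀ x y, p (μ x y) = μ (p x) (p y)}
  mul_mem' {p q} hp hq x y := by
    rw [Equiv.Perm.mul_apply, hq, hp]
    rfl
  one_mem' _ _ := rfl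
  inv_mem' {p} hp x y := by
    rw [Equiv.Perm.inv_eq_iff_eq, hp]
    simp

theorem elemRefl_mem_reflAut (rs3 : ∀ x y z, μ x (μ y z) = μ (μ x y) (μ x z)) (x : X) :
    elemRefl μ rs2 x ∈ reflAut μ := rs3 x

variable (μ rs2) in
/-- The restricted transvection group of the family `f` of points with base point `o`. -/
def restrictedTrans {ι : Type*} (f : ι → X) (o : X) : Subgroup (Equiv.Perm X) :=
  Subgroup.closure {p | ∃ g, p = elemRefl μ rs2 (f g) * elemRefl μ rs2 o}

theorem mem_restrictedTrans {ι : Type*} (f : ι → X) (o : X) (g : ι) :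
    elemRefl μ rs2 (f g) * elemRefl μ rs2 o ∈ restrictedTrans μ rs2 f o :=
  Subgroup.subset_closure ⟨g, rfl⟩

theorem restrictedTrans_le_reflAut (rs3 : ∀ x y z, μ x (μ y z) = μ (μ x y) (μ x z))
    {ι : Type*} (f : ι → X) (o : X) : restrictedTrans μ rs2 f o ≤ reflAut μ := by
  refine (Subgroup.closure_le _).2 ?_
  rintro _ ⟨g, rfl⟩
  exact mul_mem (elemRefl_mem_reflAut rs3 _) (elemRefl_mem_reflAut rs3 _)

theorem commute_of_fixes (rs3 : ∀ x y z, μ x (μ y z) = μ (μ x y) (μ x z))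
    {ι : Type*} {f : ι → X} {o : X} (ho : o ∈ Set.range f) {p q : Equiv.Perm X}
    (hp : p ∈ restrictedTrans μ rs2 f o) (hfix : ∀ g, p (f g) = f g)
    (hq : q ∈ restrictedTrans μ rs2 f o) : Commute p q := by
  have hcomm : ∀ g, Commute p (elemRefl μ rs2 (f g)) := fun g => by
    have h := conj_elemRefl (rs2 := rs2) (restrictedTrans_le_reflAut rs3 f o hp) (f g)
    rw [hfix] at h
    exact mul_inv_eq_iff_eq_mul.1 h
  obtain ⟨i, rfl⟩ := ho
  have hle : restrictedTrans μ rs2 f (f i) ≤ Subgroup.centralizer {p} := by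
    refine (Subgroup.closure_le _).2 ?_
    rintro _ ⟨g, rfl⟩
    exact Subgroup.mem_centralizer_singleton_iff.2 ((hcomm g).mul_right (hcomm i)).eq.symm
  exact (Subgroup.mem_centralizer_singleton_iff.1 (hle hq)).symm

variable {o : X} {f : SL2 → X}

/-- Every element of `SL(2,ℝ)` acts on the embedded hyperbolic plane through the restricted
transvection group. -/
theorem exists_mem_restrictedTrans_apply (hf1 : f 1 = o)
    (hfμ : ∀ g h : SL2, f (tauSL g * thetaSL h) = μ (f g) (f h)) (a : SL2) :
    ∃ p ∈ restrictedTrans μ rs2 f o, ∀ h, p (f h) = f (a * h) := by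
  have ha : a ∈ Subgroup.closure (Set.range tauSL) := by
    rw [SL2.closure_range_tauSL]
    exact Subgroup.mem_top a
  induction ha using Subgroup.closure_induction with
  | mem x hx =>
    obtain ⟨g, rfl⟩ := hx
    refine ⟨_, mem_restrictedTrans f o g, fun h => ?_⟩
    change μ (f g) (μ o (f h)) = _
    rw [← hf1, ← hfμ, ← hfμ, SL2.tauSL_one, one_mul, SL2.thetaSL_thetaSL]
  | one => exact ⟨1, one_mem _, fun h => by simp⟩
  | mul x y _ _ hx hy =>
    obtain ⟨p, hp, hpf⟩ := hx
    obtain ⟨q, hq, hqf⟩ := hy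
    exact ⟨p * q, mul_mem hp hq, fun h => by rw [Equiv.Perm.mul_apply, hqf, hpf, mul_assoc]⟩
  | inv x _ hx =>
    obtain ⟨p, hp, hpf⟩ := hx
    exact ⟨p⁻¹, inv_mem hp, fun h => by rw [Equiv.Perm.inv_eq_iff_eq, hpf, mul_inv_cancel_left]⟩

theorem commutator_restrictedTrans (rs3 : ∀ x y z, μ x (μ y z) = μ (μ x y) (μ x z))
    (hf1 : f 1 = o) (hfμ : ∀ g h : SL2, f (tauSL g * thetaSL h) = μ (f g) (f h)) :
    ⁅restrictedTrans μ rs2 f o, restrictedTrans μ rs2 f o⁆ = restrictedTrans μ rs2 f o := by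
  let T := restrictedTrans μ rs2 f o
  let t : SL2 → T := fun g => ⟨_, mem_restrictedTrans f o g⟩
  have ht : ∀ a h, ∃ p : T, t (a * h) = p * t h * p⁻¹ * t a := fun a h => by
    obtain ⟨p, hp, hpf⟩ := exists_mem_restrictedTrans_apply (rs2 := rs2) hf1 hfμ a
    have hp' := restrictedTrans_le_reflAut rs3 f o hp
    refine ⟨⟨p, hp⟩, Subtype.ext ?_⟩
    change elemRefl μ rs2 (f (a * h)) * elemRefl μ rs2 o =
      p * (elemRefl μ rs2 (f h) * elemRefl μ rs2 o) * p⁻¹ *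
        (elemRefl μ rs2 (f a) * elemRefl μ rs2 o)
    have hpo : p o = f a := by rw [← hf1, hpf, mul_one]
    rw [← hpf, ← hpo, ← conj_elemRefl hp', ← conj_elemRefl hp' o]
    simp only [mul_assoc, inv_mul_cancel_left]
    rw [← mul_assoc (elemRefl μ rs2 o) (elemRefl μ rs2 o), elemRefl_mul_self, one_mul]
  let F : SL2 →* Abelianization T := MonoidHom.mk' (fun g => Abelianization.of (t g)) fun a h => by
    obtain ⟨p, hp⟩ := ht a h
    rw [hp, map_mul, map_mul, map_mul, map_inv, mul_comm (Abelianization.of p),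
      mul_inv_cancel_right, mul_comm]
  have hF : ∀ g, F g = 1 := fun g => by
    refine Abelianization.commutator_subset_ker F ?_
    rw [SL2.commutator_eq_top]
    exact Subgroup.mem_top g
  refine le_antisymm (Subgroup.commutator_le_self _) ((Subgroup.closure_le _).2 ?_)
  rintro _ ⟨g, rfl⟩
  have hg : t g ∈ commutator T := by
    rw [← Abelianization.ker_of]
    exact hF g
  rw [SetLike.mem_coe, ← Subgroup.map_subtype_commutator]
  exact ⟨t g, hg, rfl⟩

end Reflections

/-- In the embedded-hyperbolic-plane setting, the restricted transvection
group `Trans(X)|_ℍ` (the subgroup of the permutation group of `X` generated by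
`{s_{f(g)} ∘ s_o : g ∈ SL(2,ℝ)}`) is perfect, and every element of it fixing the embedded
hyperbolic plane pointwise is central in it; hence `Trans(X)|_ℍ` is a perfect central
extension of its image in the group of bijections of the embedded hyperbolic plane. -/
theorem restricted_transvection_group_perfect_central_extension {X : Type*} (μ : X → X → X)
    (rs1 : ∀ x, μ x x = x)
    (rs2 : ∀ x y, μ x (μ x y) = y)
    (rs3 : ∀ x y z, μ x (μ y z) = μ (μ x y) (μ x z))
    (o : X) (f : SL2 → X)
    (hf1 : f 1 = o)
    (hfK : ∀ g h : SL2, f g = f h ↔ (g⁻¹ * h) * transpSL (g⁻¹ * h) = 1)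
    (hfμ : ∀ g h : SL2, f (tauSL g * thetaSL h) = μ (f g) (f h)) :
    ⁅Subgroup.closure {p : Equiv.Perm X | ∃ g : SL2, p = elemRefl μ rs2 (f g) * elemRefl μ rs2 o},
      Subgroup.closure {p : Equiv.Perm X | ∃ g : SL2, p = elemRefl μ rs2 (f g) * elemRefl μ rs2 o}⁆
      = Subgroup.closure
        {p : Equiv.Perm X | ∃ g : SL2, p = elemRefl μ rs2 (f g) * elemRefl μ rs2 o} ∧
    ∀ p ∈ Subgroup.closure
        {p : Equiv.Perm X | ∃ g : SL2, p = elemRefl μ rs2 (f g) * elemRefl μ rs2 o},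
      (∀ g : SL2, p (f g) = f g) →
      ∀ q ∈ Subgroup.closure
          {p : Equiv.Perm X | ∃ g : SL2, p = elemRefl μ rs2 (f g) * elemRefl μ rs2 o},
        p * q = q * p := by
  exact ⟨commutator_restrictedTrans rs3 hf1 hfμ, fun p hp hfix q hq =>
    commute_of_fixes rs3 ⟨1, hf1⟩ hp hfix hq⟩
end
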